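/- arXiv:1504.04870 — 2 statements merged into one kernel-verified Lean document; each statement's English description precedes it below -/
import Mathlib

section
/- Consider a monotone decreasing adaptive RWCE on ℕ where C_0 is recurrent (∑_j 1/C_0(j) = ∞) and there is c > 0 with C_t(j) ≥ c·C_0(j) for all t, j almost surely. Then the walk visits 0 infinitely often almost surely (the walk is recurrent). -/
open MeasureTheory Filter

/-- The resistance between `x` and `N` of the path with conductances `C`, zero when `N ≤ x`. -/
noncomputable def resist (N : ℕ) (C : ℕ → ℝ) (x : ℕ) : ℝ :=
  ∑ j ∈ Finset.range N, if x ≤ j then (C j)⁻¹ else 0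

lemma resist_eq_succ_add (N : ℕ) (C : ℕ → ℝ) (x : ℕ) :
    resist N C x = resist N C (x + 1) + if x < N then (C x)⁻¹ else 0 := by
  have h : (if x < N then (C x)⁻¹ else 0)
      = ∑ j ∈ Finset.range N, if x = j then (C j)⁻¹ else 0 := by
    simp
  rw [h, resist, resist, ← Finset.sum_add_distrib]
  refine Finset.sum_congr rfl fun j _ => ?_
  rcases lt_trichotomy x j with h | h | h
  · simp [h.le, h.ne, Nat.succ_le_of_lt h]
  · simp [h]
  · have h1 : ¬ x ≤ j := by omega
    have h2 : ¬ x + 1 ≤ j := by omega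
    have h3 : x ≠ j := by omega
    simp [h1, h2, h3]

lemma resist_nonneg {N : ℕ} {C : ℕ → ℝ} (hC : ∀ j, 0 < C j) (x : ℕ) : 0 ≤ resist N C x := by
  refine Finset.sum_nonneg fun j _ => ?_
  have := (inv_pos.2 (hC j)).le
  split_ifs <;> simp [this]

lemma resist_zero (N : ℕ) (C : ℕ → ℝ) : resist N C 0 = ∑ j ∈ Finset.range N, (C j)⁻¹ := by
  simp [resist]

lemma resist_of_le {N : ℕ} (C : ℕ → ℝ) {x : ℕ} (h : N ≤ x) : resist N C x = 0 := by
  refine Finset.sum_eq_zero fun j hj => if_neg ?_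
  have := Finset.mem_range.1 hj
  omega

lemma resist_anti {N : ℕ} {C C' : ℕ → ℝ} (hC' : ∀ j, 0 < C' j) (h : ∀ j, C' j ≤ C j) (x : ℕ) :
    resist N C x ≤ resist N C' x := by
  refine Finset.sum_le_sum fun j _ => ?_
  split_ifs
  · exact inv_anti₀ (hC' j) (h j)
  · rfl

lemma mul_resist_le {N : ℕ} {C C' : ℕ → ℝ} {c : ℝ} (hc : 0 < c) (hC : ∀ j, 0 < C j)
    (h : ∀ j, c * C j ≤ C' j) (x : ℕ) : c * resist N C' x ≤ resist N C 0 := by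
  rw [resist_zero, resist, Finset.mul_sum]
  refine Finset.sum_le_sum fun j _ => ?_
  have h0 := inv_pos.2 (hC j)
  split_ifs
  · have h1 := inv_anti₀ (mul_pos hc (hC j)) (h j)
    calc c * (C' j)⁻¹ ≤ c * (c * C j)⁻¹ := by gcongr
      _ = (C j)⁻¹ := by field_simp
  · simpa using h0.le

lemma resist_zero_sub_le {N : ℕ} {C : ℕ → ℝ} (hC : ∀ j, 0 < C j) (x : ℕ) :
    resist N C 0 - ∑ j ∈ Finset.range x, (C j)⁻¹ ≤ resist N C x := by
  induction x with
  | zero => simp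
  | succ x ih =>
    rw [Finset.sum_range_succ]
    have h := resist_eq_succ_add N C x
    have h0 := inv_pos.2 (hC x)
    split_ifs at h <;> linarith

/-- `resist N C` is subharmonic away from `0` for the walk with conductances `C`. -/
lemma resist_subharmonic {N : ℕ} {C : ℕ → ℝ} (hC : ∀ j, 0 < C j) {x : ℕ} (hx : x ≠ 0) :
    resist N C x ≤ (resist N C (x + 1) - resist N C (x - 1)) * (C x / (C x + C (x - 1)))
      + resist N C (x - 1) := by
  obtain ⟨y, rfl⟩ := Nat.exists_eq_succ_of_ne_zero hx
  simp only [Nat.succ_eq_add_one, Nat.add_sub_cancel]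
  have h1 := resist_eq_succ_add N C y
  have h2 := resist_eq_succ_add N C (y + 1)
  have p1 := hC y
  have p2 := hC (y + 1)
  rcases lt_trichotomy (y + 1) N with h | h | h
  · rw [if_pos (by omega)] at h1 h2
    rw [h1, h2]
    apply le_of_eq
    field_simp
    ring
  · rw [if_pos (by omega)] at h1
    rw [if_neg (by omega)] at h2
    rw [h1, h2]
    have : C (y + 1) / (C (y + 1) + C y) ≤ 1 := (div_le_one (by positivity)).2 (by linarith)
    have h3 : 0 < (C y)⁻¹ := by positivity
    nlinarith
  · rw [if_neg (by omega)] at h1 h2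
    rw [h1, h2]
    simp

/-- A nearest neighbour path along which the resistance to `N` converges ends up beyond `N`. -/
lemma eventually_le_of_tendsto_resist {N : ℕ} {C : ℕ → ℕ → ℝ} {x : ℕ → ℕ} {L : ℝ}
    (hC : ∀ t j, 0 < C t j) (hmono : ∀ t j, C (t + 1) j ≤ C t j)
    (hnn : ∀ t, x (t + 1) = x t + 1 ∨ x (t + 1) + 1 = x t)
    (hL : Tendsto (fun t => resist N (C t) (x t)) atTop (nhds L)) :
    ∀ᶠ t in atTop, N ≤ x t := by
  have hanti : ∀ t j, C t j ≤ C 0 j := fun t j =>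
    antitone_nat_of_succ_le (f := fun t => C t j) (fun t => hmono t j) (Nat.zero_le t)
  obtain ⟨e, he, hej⟩ : ∃ e > 0, ∀ j < N, e ≤ (C 0 j)⁻¹ := by
    have hpos : 0 < 1 + ∑ j ∈ Finset.range N, C 0 j :=
      add_pos_of_pos_of_nonneg one_pos (Finset.sum_nonneg fun j _ => (hC 0 j).le)
    refine ⟨(1 + ∑ j ∈ Finset.range N, C 0 j)⁻¹, inv_pos.2 hpos, fun j hj => ?_⟩
    refine inv_anti₀ (hC 0 j) ?_
    have := Finset.single_le_sum (f := C 0) (fun i _ => (hC 0 i).le) (Finset.mem_range.2 hj)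
    linarith
  have hdiff : Tendsto (fun t => resist N (C (t + 1)) (x (t + 1)) - resist N (C t) (x t))
      atTop (nhds 0) := by
    simpa using (hL.comp (tendsto_add_atTop_nat 1)).sub hL
  obtain ⟨T, hT⟩ := eventually_atTop.1 (hdiff.eventually_lt_const he)
  have hup : ∀ t ≥ T, x (t + 1) = x t + 1 ∨ N ≤ x (t + 1) := by
    intro t ht
    rcases hnn t with h | h
    · exact Or.inl h
    · refine Or.inr ?_
      by_contra! hlt
      have h1 := resist_eq_succ_add N (C t) (x (t + 1))
      rw [if_pos hlt, h] at h1
      have h2 := resist_anti (N := N) (hC (t + 1)) (hmono t) (x (t + 1))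
      have h3 := inv_anti₀ (hC t (x (t + 1))) (hanti t (x (t + 1)))
      linarith [hT t ht, hej _ hlt]
  have hmin : ∀ k, min k N ≤ x (T + k) := by
    intro k
    induction k with
    | zero => simp
    | succ k ih =>
      have := hup (T + k) (by omega)
      rw [← add_assoc]
      omega
  refine eventually_atTop.2 ⟨T + N, fun t ht => ?_⟩
  have := hmin (t - T)
  rw [Nat.add_sub_of_le (by omega)] at this
  omega

lemma measurable_resist {Ω : Type*} {m : MeasurableSpace Ω} (N : ℕ) {C : ℕ → Ω → ℝ} {X : Ω → ℕ}
    (hC : ∀ j, Measurable (C j)) (hX : Measurable X) :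
    Measurable fun ω => resist N (fun j => C j ω) (X ω) := by
  refine Finset.measurable_sum _ fun j _ => Measurable.ite ?_ (hC j).inv measurable_const
  exact hX (measurableSet_Iic (a := j))

lemma le_condExp_of_tendsto {Ω : Type*} {m m0 : MeasurableSpace Ω} {μ : Measure Ω}
    [IsFiniteMeasure μ] (hm : m ≤ m0) {f g : Ω → ℝ} {V : ℕ → Ω → ℝ} {K : ℝ}
    (hf : StronglyMeasurable[m] f) (hfi : Integrable f μ)
    (hVm : ∀ n, AEStronglyMeasurable (V n) μ) (hVb : ∀ n, ∀ᵐ ω ∂μ, ‖V n ω‖ ≤ K)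
    (hV : ∀ᵐ ω ∂μ, Tendsto (fun n => V n ω) atTop (nhds (g ω))) (hg : Integrable g μ)
    (hle : ∀ n, f ≤ᵐ[μ] μ[V n | m]) : f ≤ᵐ[μ] μ[g | m] := by
  suffices h : f ≤ᵐ[μ.trim hm] μ[g | m] from ae_le_of_ae_le_trim h
  refine ae_le_of_forall_setIntegral_le (hfi.trim hm hf)
    (integrable_condExp.trim hm stronglyMeasurable_condExp) fun s hs _ => ?_
  rw [← setIntegral_trim hm hf hs, ← setIntegral_trim hm stronglyMeasurable_condExp hs,
    setIntegral_condExp hm hg hs]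
  have hVi : ∀ n, Integrable (V n) μ := fun n => Integrable.of_bound (hVm n) K (hVb n)
  have hlim : Tendsto (fun n => ∫ ω in s, V n ω ∂μ) atTop (nhds (∫ ω in s, g ω ∂μ)) :=
    tendsto_integral_of_dominated_convergence (fun _ => K) (fun n => (hVm n).restrict)
      (integrable_const K) (fun n => ae_restrict_of_ae (hVb n)) (ae_restrict_of_ae hV)
  refine ge_of_tendsto' hlim fun n => ?_
  rw [← setIntegral_condExp hm (hVi n) hs]
  exact setIntegral_mono_ae hfi.integrableOn integrable_condExp.integrableOn (hle n)

/-- The walk hits `0` with conditional probability at least `c`. -/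
lemma rwce_decreasing_hit_prob_ge
    {Ω : Type*} {m0 : MeasurableSpace Ω} {μ : Measure Ω} [IsProbabilityMeasure μ]
    (𝓕 : Filtration ℕ m0)
    (X : ℕ → Ω → ℕ) (C : ℕ → ℕ → Ω → ℝ)
    (hXadp : ∀ t, Measurable[𝓕 t] (X t))
    (hCadp : ∀ t j, Measurable[𝓕 t] (C t j))
    (hCpos : ∀ᵐ ω ∂μ, ∀ t j, 0 < C t j ω)
    (hmono : ∀ᵐ ω ∂μ, ∀ t j, C (t + 1) j ω ≤ C t j ω)
    (h0rec : ∀ᵐ ω ∂μ, ¬ Summable (fun j => 1 / C 0 j ω))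
    (c : ℝ) (hc : 0 < c)
    (hbound : ∀ᵐ ω ∂μ, ∀ t j, c * C 0 j ω ≤ C t j ω)
    (hnn : ∀ᵐ ω ∂μ, ∀ t, X (t + 1) ω = X t ω + 1 ∨ X (t + 1) ω + 1 = X t ω)
    (hstep : ∀ t,
      μ[(fun ω => if X (t + 1) ω = X t ω + 1 then (1 : ℝ) else 0) | 𝓕 t]
        =ᵐ[μ] fun ω => if X t ω = 0 then 1
          else C t (X t ω) ω / (C t (X t ω) ω + C t (X t ω - 1) ω)) :
    ∀ᵐ ω ∂μ, c ≤ (μ[{ω | ∃ t, X t ω = 0}.indicator (fun _ => (1 : ℝ)) | 𝓕 0]) ω := by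
  classical
  set A : Set Ω := {ω | ∃ t, X t ω = 0} with hA
  have hAm : MeasurableSet A := by
    have : A = ⋃ t, X t ⁻¹' {0} := by ext; simp [hA]
    rw [this]
    exact MeasurableSet.iUnion fun t => ((hXadp t).mono (𝓕.le t) le_rfl) (measurableSet_singleton 0)
  have hAi : Integrable (A.indicator fun _ => (1 : ℝ)) μ := (integrable_const 1).indicator hAm
  let u : ℕ → ℕ → ℕ → Ω → ℝ := fun N t x ω =>
    c * resist N (fun j => C t j ω) x / resist N (fun j => C 0 j ω) 0
  have hu_meas : ∀ N t (Y : Ω → ℕ), Measurable[𝓕 t] Y → Measurable[𝓕 t] fun ω => u N t (Y ω) ω := by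
    intro N t Y hY
    exact ((measurable_resist (m := 𝓕 t) N (hCadp t) hY).const_mul c).div
      (measurable_resist (m := 𝓕 t) N (fun j => (hCadp 0 j).mono (𝓕.mono (Nat.zero_le t)) le_rfl)
        (measurable_const (a := 0)))
  have hu_bd : ∀ᵐ ω ∂μ, ∀ N t x, 0 ≤ u N t x ω ∧ u N t x ω ≤ 1 := by
    filter_upwards [hCpos, hbound] with ω hp hb N t x
    have h0 : 0 ≤ resist N (fun j => C 0 j ω) 0 := resist_nonneg (hp 0) 0
    exact ⟨div_nonneg (mul_nonneg hc.le (resist_nonneg (hp t) x)) h0,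
      div_le_one_of_le₀ (mul_resist_le hc (hp 0) (hb t) x) h0⟩
  have hu_mono : ∀ᵐ ω ∂μ, ∀ N t x, u N t x ω ≤ u N (t + 1) x ω := by
    filter_upwards [hCpos, hmono] with ω hp hm N t x
    have h0 : 0 ≤ resist N (fun j => C 0 j ω) 0 := resist_nonneg (hp 0) 0
    have h1 := resist_anti (N := N) (hp (t + 1)) (hm t) x
    exact div_le_div_of_nonneg_right (mul_le_mul_of_nonneg_left h1 hc.le) h0
  have hu_sub : ∀ᵐ ω ∂μ, ∀ N t x, x ≠ 0 → u N t x ω ≤ (u N t (x + 1) ω - u N t (x - 1) ω) *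
      (C t x ω / (C t x ω + C t (x - 1) ω)) + u N t (x - 1) ω := by
    filter_upwards [hCpos] with ω hp N t x hx
    have h0 : 0 ≤ resist N (fun j => C 0 j ω) 0 := resist_nonneg (hp 0) 0
    have h1 := resist_subharmonic (N := N) (hp t) hx
    refine (div_le_div_of_nonneg_right (mul_le_mul_of_nonneg_left h1 hc.le) h0).trans_eq ?_
    simp only [u]
    ring
  let H : ℕ → Set Ω := fun t => {ω | ∃ s ≤ t, X s ω = 0}
  have hH : ∀ t, MeasurableSet[𝓕 t] (H t) := by
    intro t
    have : H t = ⋃ s ∈ Set.Iic t, X s ⁻¹' {0} := by ext; simp [H]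
    rw [this]
    exact MeasurableSet.biUnion (Set.to_countable _) fun s hs =>
      ((hXadp s).mono (𝓕.mono hs) le_rfl) (measurableSet_singleton 0)
  let V : ℕ → ℕ → Ω → ℝ := fun N t ω => if ω ∈ H t then 1 else u N t (X t ω) ω
  have hVm : ∀ N t, Measurable[𝓕 t] (V N t) := fun N t =>
    Measurable.ite (hH t) measurable_const (hu_meas N t _ (hXadp t))
  have hVbd : ∀ N t, ∀ᵐ ω ∂μ, ‖V N t ω‖ ≤ 1 := by
    intro N t
    filter_upwards [hu_bd] with ω hω
    have := hω N t (X t ω)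
    simp only [V]
    split_ifs
    · simp
    · rw [Real.norm_of_nonneg this.1]; exact this.2
  have hVi : ∀ N t, Integrable (V N t) μ := fun N t =>
    Integrable.of_bound ((hVm N t).mono (𝓕.le t) le_rfl).aestronglyMeasurable 1 (hVbd N t)
  have hsub : ∀ N, Submartingale (V N) 𝓕 μ := by
    intro N
    refine submartingale_nat (fun t => (hVm N t).stronglyMeasurable) (hVi N) fun t => ?_
    let a : Ω → ℝ := fun ω => if ω ∈ H t then 0 else u N t (X t ω + 1) ω - u N t (X t ω - 1) ω
    let b : Ω → ℝ := fun ω => if ω ∈ H t then 1 else u N t (X t ω - 1) ω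
    let r : Ω → ℝ := fun ω => if X (t + 1) ω = X t ω + 1 then (1 : ℝ) else 0
    have hum := hu_meas N t _ ((measurable_from_top (f := fun x : ℕ => x - 1)).comp (hXadp t))
    have hup := hu_meas N t _ ((measurable_from_top (f := fun x : ℕ => x + 1)).comp (hXadp t))
    have ham : Measurable[𝓕 t] a := Measurable.ite (hH t) measurable_const (hup.sub hum)
    have hbm : Measurable[𝓕 t] b := Measurable.ite (hH t) measurable_const hum
    have hrm : Measurable r := Measurable.ite
      (measurableSet_eq_fun ((hXadp (t + 1)).mono (𝓕.le _) le_rfl)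
        ((measurable_from_top (f := fun x : ℕ => x + 1)).comp ((hXadp t).mono (𝓕.le _) le_rfl)))
      measurable_const measurable_const
    have hab : ∀ᵐ ω ∂μ, ‖a ω‖ ≤ 1 := by
      filter_upwards [hu_bd] with ω hω
      have h1 := hω N t (X t ω + 1)
      have h2 := hω N t (X t ω - 1)
      simp only [a]
      split_ifs
      · simp
      · rw [Real.norm_eq_abs, abs_le]; constructor <;> linarith
    have hbb : ∀ᵐ ω ∂μ, ‖b ω‖ ≤ 1 := by
      filter_upwards [hu_bd] with ω hω
      have h2 := hω N t (X t ω - 1)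
      simp only [b]
      split_ifs
      · simp
      · rw [Real.norm_of_nonneg h2.1]; exact h2.2
    have hri : Integrable r μ := Integrable.of_bound hrm.aestronglyMeasurable 1
      (ae_of_all _ fun ω => by simp only [r]; split_ifs <;> simp)
    have hbi : Integrable b μ :=
      Integrable.of_bound (hbm.mono (𝓕.le t) le_rfl).aestronglyMeasurable 1 hbb
    have hari : Integrable (a * r) μ :=
      hri.bdd_mul (c := 1) (ham.mono (𝓕.le t) le_rfl).aestronglyMeasurable hab
    have hle : a * r + b ≤ᵐ[μ] V N (t + 1) := by
      filter_upwards [hu_bd, hu_mono, hnn] with ω hb hm hn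
      simp only [Pi.add_apply, Pi.mul_apply, a, b, r, V]
      by_cases h : ω ∈ H t
      · have h' : ω ∈ H (t + 1) := by
          obtain ⟨s, hs, hs0⟩ := h
          exact ⟨s, hs.trans (Nat.le_succ t), hs0⟩
        simp [h, h']
      · have hX : X t ω ≠ 0 := fun h0 => h ⟨t, le_rfl, h0⟩
        have key : (u N t (X t ω + 1) ω - u N t (X t ω - 1) ω) *
            (if X (t + 1) ω = X t ω + 1 then (1 : ℝ) else 0) + u N t (X t ω - 1) ω
            = u N t (X (t + 1) ω) ω := by
          rcases hn t with h1 | h1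
          · simp [h1]
          · have h2 : X t ω - 1 = X (t + 1) ω := by omega
            have h3 : X (t + 1) ω ≠ X t ω + 1 := by omega
            simp [h2, h3]
        rw [if_neg h, if_neg h, key]
        split_ifs
        · exact (hb N t _).2
        · exact hm N t _
    have hce : μ[a * r + b | 𝓕 t] =ᵐ[μ] a * μ[r | 𝓕 t] + b := by
      have h1 := condExp_stronglyMeasurable_mul_of_bound (𝓕.le t) ham.stronglyMeasurable hri 1 hab
      have h2 := condExp_add hari hbi (𝓕 t)
      rw [condExp_of_stronglyMeasurable (𝓕.le t) hbm.stronglyMeasurable hbi] at h2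
      filter_upwards [h1, h2] with ω h1 h2
      rw [h2, Pi.add_apply, h1, Pi.add_apply]
    have hcm := condExp_mono (m := 𝓕 t) (hari.add hbi) (hVi N (t + 1)) hle
    filter_upwards [hce, hcm, hstep t, hu_sub] with ω h1 h2 h3 h4
    refine le_trans ?_ (h1.symm.trans_le h2)
    simp only [Pi.add_apply, Pi.mul_apply, r, h3]
    simp only [a, b, V]
    by_cases h : ω ∈ H t
    · simp [h]
    · have hX : X t ω ≠ 0 := fun h0 => h ⟨t, le_rfl, h0⟩
      simp only [if_neg h, if_neg hX]
      exact h4 N t _ hX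
  have hlim : ∀ N, ∀ᵐ ω ∂μ, Tendsto (fun t => V N t ω) atTop
      (nhds (A.indicator (fun _ => (1 : ℝ)) ω)) := by
    intro N
    have hbd : ∀ t, eLpNorm (V N t) 1 μ ≤ ((1 : NNReal) : ENNReal) := fun t =>
      (eLpNorm_le_of_ae_bound (hVbd N t)).trans (by simp)
    filter_upwards [(hsub N).exists_ae_tendsto_of_bdd hbd, hCpos, hmono, hnn]
      with ω ⟨l, hl⟩ hp hm hn
    by_cases h : ω ∈ A
    · obtain ⟨s, hs⟩ := h
      rw [Set.indicator_of_mem (show ω ∈ A from ⟨s, hs⟩)]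
      refine tendsto_const_nhds.congr' ?_
      filter_upwards [eventually_ge_atTop s] with t ht
      exact (if_pos (show ω ∈ H t from ⟨s, ht, hs⟩)).symm
    · rw [Set.indicator_of_notMem h]
      have hV : ∀ t, V N t ω = u N t (X t ω) ω := fun t =>
        if_neg fun ⟨s, _, hs⟩ => h ⟨s, hs⟩
      simp only [hV] at hl ⊢
      have hev : ∀ᶠ t in atTop, N ≤ X t ω := by
        rcases Nat.eq_zero_or_pos N with rfl | hN
        · simp
        have hS : 0 < resist N (fun j => C 0 j ω) 0 := by
          rw [resist_zero]
          exact Finset.sum_pos (fun j _ => inv_pos.2 (hp 0 j)) ⟨0, Finset.mem_range.2 hN⟩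
        refine eventually_le_of_tendsto_resist (C := fun t j => C t j ω)
          (L := l * (resist N (fun j => C 0 j ω) 0 / c)) hp hm hn ?_
        refine (hl.mul_const (resist N (fun j => C 0 j ω) 0 / c)).congr fun t => ?_
        simp only [u]
        field_simp
      refine tendsto_const_nhds.congr' ?_
      filter_upwards [hev] with t ht
      simp [u, resist_of_le _ ht]
  have hmain : ∀ N, V N 0 ≤ᵐ[μ] μ[A.indicator (fun _ => (1 : ℝ)) | 𝓕 0] := fun N =>
    le_condExp_of_tendsto (𝓕.le 0) (hVm N 0).stronglyMeasurable (hVi N 0)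
      (fun t => (hVi N t).aestronglyMeasurable) (hVbd N) (hlim N) hAi
      fun t => (hsub N).2.1 0 t (Nat.zero_le t)
  filter_upwards [ae_all_iff.2 hmain, hu_bd, hCpos, h0rec] with ω hω hb hp hr
  have hS : Tendsto (fun N => resist N (fun j => C 0 j ω) 0) atTop atTop := by
    simp only [resist_zero]
    simpa only [one_div] using (not_summable_iff_tendsto_nat_atTop_of_nonneg
      (fun j => (one_div_pos.2 (hp 0 j)).le)).1 hr
  set s : ℝ := ∑ j ∈ Finset.range (X 0 ω), (C 0 j ω)⁻¹ with hs
  have ht : Tendsto (fun N => c * (1 - s / resist N (fun j => C 0 j ω) 0)) atTop (nhds c) := by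
    simpa using ((hS.const_div_atTop s).const_sub 1).const_mul c
  refine le_of_tendsto ht ?_
  filter_upwards [hS.eventually_gt_atTop 0] with N hN
  refine le_trans ?_ (hω N)
  have h1 : u N 0 (X 0 ω) ω ≤ V N 0 ω := by
    simp only [V]
    split_ifs
    · exact (hb N 0 _).2
    · rfl
  refine le_trans ?_ h1
  have h2 := resist_zero_sub_le (N := N) (hp 0) (X 0 ω)
  calc c * (1 - s / resist N (fun j => C 0 j ω) 0)
      = c * (resist N (fun j => C 0 j ω) 0 - s) / resist N (fun j => C 0 j ω) 0 := by
        field_simp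
    _ ≤ u N 0 (X 0 ω) ω :=
        div_le_div_of_nonneg_right (mul_le_mul_of_nonneg_left h2 hc.le) hN.le

/-- The filtration `𝓕` observed from time `n` on. -/
def shiftFiltration {Ω : Type*} {m0 : MeasurableSpace Ω} (𝓕 : Filtration ℕ m0) (n : ℕ) :
    Filtration ℕ m0 where
  seq t := 𝓕 (n + t)
  mono' _ _ h := 𝓕.mono (Nat.add_le_add_left h n)
  le' t := 𝓕.le (n + t)

/-- **RWCE on ℕ, monotone decreasing, `C₀` recurrent, `C t ≥ c·C 0`.**
Then the walk visits `0` infinitely often almost surely. -/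
theorem rwce_decreasing_recurrent
    {Ω : Type*} {m0 : MeasurableSpace Ω} {μ : Measure Ω} [IsProbabilityMeasure μ]
    (𝓕 : Filtration ℕ m0)
    (X : ℕ → Ω → ℕ) (C : ℕ → ℕ → Ω → ℝ)
    (hXadp : ∀ t, Measurable[𝓕 t] (X t))
    (hCadp : ∀ t j, Measurable[𝓕 t] (C t j))
    (hCpos : ∀ᵐ ω ∂μ, ∀ t j, 0 < C t j ω)
    (hmono : ∀ᵐ ω ∂μ, ∀ t j, C (t + 1) j ω ≤ C t j ω)
    (h0rec : ∀ᵐ ω ∂μ, ¬ Summable (fun j => 1 / C 0 j ω))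
    (c : ℝ) (hc : 0 < c)
    (hbound : ∀ᵐ ω ∂μ, ∀ t j, c * C 0 j ω ≤ C t j ω)
    (hnn : ∀ᵐ ω ∂μ, ∀ t, X (t + 1) ω = X t ω + 1 ∨ X (t + 1) ω + 1 = X t ω)
    (hstep : ∀ t,
      μ[(fun ω => if X (t + 1) ω = X t ω + 1 then (1 : ℝ) else 0) | 𝓕 t]
        =ᵐ[μ] fun ω => if X t ω = 0 then 1
          else C t (X t ω) ω / (C t (X t ω) ω + C t (X t ω - 1) ω)) :
    ∀ᵐ ω ∂μ, {t | X t ω = 0}.Infinite := by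
  let A : ℕ → Set Ω := fun n => {ω | ∃ t, X (n + t) ω = 0}
  have hanti : ∀ᵐ ω ∂μ, ∀ t j, C t j ω ≤ C 0 j ω := by
    filter_upwards [hmono] with ω hm t j
    exact antitone_nat_of_succ_le (f := fun t => C t j ω) (fun t => hm t j) (Nat.zero_le t)
  have hprob : ∀ n, ∀ᵐ ω ∂μ, c ≤ (μ[(A n).indicator (fun _ => (1 : ℝ)) | 𝓕 n]) ω := by
    intro n
    refine rwce_decreasing_hit_prob_ge (shiftFiltration 𝓕 n) (fun t => X (n + t))
      (fun t => C (n + t)) (fun t => hXadp (n + t)) (fun t => hCadp (n + t)) ?_ ?_ ?_ c hc ?_ ?_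
      (fun t => hstep (n + t))
    · filter_upwards [hCpos] with ω h t j using h (n + t) j
    · filter_upwards [hmono] with ω h t j using h (n + t) j
    · filter_upwards [h0rec, hCpos, hanti] with ω h hp hm hsum
      refine h (hsum.of_nonneg_of_le (fun j => (one_div_pos.2 (hp 0 j)).le) fun j => ?_)
      exact one_div_le_one_div_of_le (hp _ j) (hm _ j)
    · filter_upwards [hbound, hanti] with ω hb hm t j
      exact (mul_le_mul_of_nonneg_left (hm _ j) hc.le).trans (hb (n + t) j)
    · filter_upwards [hnn] with ω h t using h (n + t)
  have hAsup : ∀ n, MeasurableSet[⨆ k, 𝓕 k] (A n) := by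
    intro n
    have : A n = ⋃ t, X (n + t) ⁻¹' {0} := by ext; simp [A]
    rw [this]
    exact MeasurableSet.iUnion fun t =>
      ((hXadp (n + t)).mono (le_iSup (fun k => 𝓕 k) (n + t)) le_rfl) (measurableSet_singleton 0)
  have hAi : ∀ n, Integrable ((A n).indicator fun _ => (1 : ℝ)) μ := fun n =>
    (integrable_const 1).indicator ((iSup_le fun k => 𝓕.le k) _ (hAsup n))
  have hmem : ∀ n, ∀ᵐ ω ∂μ, ω ∈ A n := by
    intro n
    have hge : ∀ k, ∀ᵐ ω ∂μ, n ≤ k → c ≤ (μ[(A n).indicator (fun _ => (1 : ℝ)) | 𝓕 k]) ω := by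
      intro k
      by_cases hk : n ≤ k
      · have hsub : A k ⊆ A n := fun ω ⟨t, ht⟩ =>
          ⟨k - n + t, by rwa [← add_assoc, Nat.add_sub_of_le hk]⟩
        have hle := condExp_mono (m := 𝓕 k) (hAi k) (hAi n) (ae_of_all μ
          (Set.indicator_le_indicator_of_subset hsub fun _ => zero_le_one))
        filter_upwards [hprob k, hle] with ω h1 h2 _ using h1.trans h2
      · exact ae_of_all _ fun ω h => absurd h hk
    filter_upwards [ae_all_iff.2 hge, (hAi n).tendsto_ae_condExp (ℱ := 𝓕)
      (stronglyMeasurable_const.indicator (hAsup n))] with ω h1 h2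
    by_contra hω
    rw [Set.indicator_of_notMem hω] at h2
    exact absurd (ge_of_tendsto h2 (eventually_atTop.2 ⟨n, h1⟩)) (not_le.2 hc)
  filter_upwards [ae_all_iff.2 hmem] with ω hω
  refine Set.infinite_of_forall_exists_gt fun n => ?_
  obtain ⟨t, ht⟩ := hω (n + 1)
  exact ⟨n + 1 + t, ht, by omega⟩
end

section
/- Let (X_t, C_t) be a monotone decreasing adaptive RWCE on a locally finite tree T with root 0, bounded below by conductances C_∞ such that the network (T, C_∞) is transient (finite effective resistance R from root to infinity). Then the walk visits every vertex finitely often almost surely (the walk is transient). -/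
open MeasureTheory Finset

/-- A unit flow from `root` to infinity on the network `G`: antisymmetric, supported on
edges, with zero divergence away from `root` and divergence `1` at `root`. -/
def IsUnitFlow {V : Type*} (G : SimpleGraph V) [G.LocallyFinite] [DecidableEq V]
    (root : V) (θ : V → V → ℝ) : Prop :=
  (∀ u v, θ u v = -θ v u) ∧ (∀ u v, ¬ G.Adj u v → θ u v = 0) ∧
  (∀ v, v ≠ root → ∑ u ∈ G.neighborFinset v, θ v u = 0) ∧
  (∑ u ∈ G.neighborFinset root, θ root u = 1)

/-- `par` and `d` are the parent map and the depth of the tree `G` rooted at `root`. -/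
structure IsParentMap {V : Type*} (G : SimpleGraph V) (root : V) (par : V → V) (d : V → ℕ) :
    Prop where
  depth_root : d root = 0
  par_root : par root = root
  adj_par : ∀ v, v ≠ root → G.Adj (par v) v
  depth_eq : ∀ v, v ≠ root → d v = d (par v) + 1
  par_eq : ∀ u v, G.Adj u v → d v = d u + 1 → par v = u
  depth_adj : ∀ u v, G.Adj u v → d u = d v + 1 ∨ d v = d u + 1

lemma SimpleGraph.IsTree.exists_isParentMap {V : Type*} {G : SimpleGraph V} (hG : G.IsTree)
    (root : V) : ∃ par d, IsParentMap G root par d := by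
  classical
  have hex : ∀ v, v ≠ root → ∃ u, G.Adj u v ∧ G.dist root v = G.dist root u + 1 := by
    intro v hv
    obtain ⟨p, -, hl⟩ := hG.connected.exists_path_of_dist root v
    have hnil : ¬ p.Nil := SimpleGraph.Walk.not_nil_of_ne hv.symm
    refine ⟨p.penultimate, p.adj_penultimate hnil, ?_⟩
    have h1 := SimpleGraph.dist_le p.dropLast
    have h2 : p.dropLast.length + 1 = p.length := SimpleGraph.Walk.length_dropLast_add_one hnil
    rcases hG.dist_eq_dist_add_one_of_adj root (p.adj_penultimate hnil) with h | h <;> omega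
  choose! f hf using hex
  have huniq : ∀ u u' v, G.Adj u v → G.Adj u' v → G.dist root v = G.dist root u + 1 →
      G.dist root v = G.dist root u' + 1 → u = u' := by
    intro u u' v hu hu' hd hd'
    obtain ⟨p, -, hl⟩ := hG.connected.exists_path_of_dist root u
    obtain ⟨q, -, hl'⟩ := hG.connected.exists_path_of_dist root u'
    have hp : (p.concat hu).IsPath := SimpleGraph.Walk.isPath_of_length_eq_dist _ (by simp [hl, hd])
    have hq : (q.concat hu').IsPath :=
      SimpleGraph.Walk.isPath_of_length_eq_dist _ (by simp [hl', hd'])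
    have := (hG.existsUnique_path root v).unique hp hq
    simpa using congrArg SimpleGraph.Walk.penultimate this
  refine ⟨fun v => if v = root then root else f v, G.dist root, by simp, by simp, ?_, ?_, ?_, ?_⟩
  · intro v hv
    simpa [hv] using (hf v hv).1
  · intro v hv
    simpa [hv] using (hf v hv).2
  · intro u v huv hd
    have hv : v ≠ root := by rintro rfl; simp at hd
    simpa [hv] using huniq _ _ v (hf v hv).1 huv (hf v hv).2 hd
  · intro u v huv
    exact hG.dist_eq_dist_add_one_of_adj root huv

namespace IsParentMap

variable {V : Type*} {G : SimpleGraph V} {root : V} {par : V → V} {d : V → ℕ}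

/-- The children of `v`: its neighbours of larger depth. -/
def children [G.LocallyFinite] (_ : IsParentMap G root par d) (v : V) : Finset V :=
  (G.neighborFinset v).filter fun w => d w = d v + 1

lemma mem_children [G.LocallyFinite] (h : IsParentMap G root par d) {v w : V} :
    w ∈ h.children v ↔ G.Adj v w ∧ d w = d v + 1 := by
  simp [children]

lemma ne_root_of_mem_children [G.LocallyFinite] (h : IsParentMap G root par d) {v w : V}
    (hw : w ∈ h.children v) : w ≠ root := by
  rintro rfl
  have := (h.mem_children.1 hw).2
  rw [h.depth_root] at this
  omega

lemma par_of_mem_children [G.LocallyFinite] (h : IsParentMap G root par d) {v w : V}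
    (hw : w ∈ h.children v) : par w = v :=
  h.par_eq _ _ (h.mem_children.1 hw).1 (h.mem_children.1 hw).2

lemma neighborFinset_root [G.LocallyFinite] (h : IsParentMap G root par d) :
    G.neighborFinset root = h.children root := by
  ext w
  rw [h.mem_children, SimpleGraph.mem_neighborFinset]
  refine ⟨fun hw => ⟨hw, ?_⟩, And.left⟩
  have := h.depth_adj _ _ hw
  rw [h.depth_root] at *
  omega

lemma sum_neighborFinset [G.LocallyFinite] (h : IsParentMap G root par d) {v : V}
    (hv : v ≠ root) (f : V → ℝ) :
    ∑ w ∈ G.neighborFinset v, f w = f (par v) + ∑ w ∈ h.children v, f w := by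
  classical
  have hd := h.depth_eq v hv
  have hins : G.neighborFinset v = insert (par v) (h.children v) := by
    ext w
    rw [Finset.mem_insert, h.mem_children, SimpleGraph.mem_neighborFinset]
    constructor
    · intro hw
      rcases h.depth_adj _ _ hw with h1 | h1
      · exact Or.inl (h.par_eq _ _ hw.symm h1).symm
      · exact Or.inr ⟨hw, h1⟩
    · rintro (rfl | hw)
      · exact (h.adj_par v hv).symm
      · exact hw.1
  rw [hins, Finset.sum_insert]
  rw [h.mem_children]
  omega

lemma induction_par (h : IsParentMap G root par d) {P : V → Prop} (hroot : P root)
    (hstep : ∀ v, v ≠ root → P (par v) → P v) (v : V) : P v := by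
  induction hn : d v generalizing v with
  | zero =>
    by_cases hv : v = root
    · exact hv ▸ hroot
    · have := h.depth_eq v hv
      omega
  | succ n ih =>
    by_cases hv : v = root
    · exact hv ▸ hroot
    · have := h.depth_eq v hv
      exact hstep v hv (ih _ (by omega))

/-- The sum of `f` over the vertices other than the root on the path from the root to `v`. -/
def pathSum (par : V → V) (d : V → ℕ) (f : V → ℝ) (v : V) : ℝ :=
  ∑ i ∈ Finset.range (d v), f (par^[i] v)

lemma pathSum_root (h : IsParentMap G root par d) (f : V → ℝ) : pathSum par d f root = 0 := by
  simp [pathSum, h.depth_root]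

lemma pathSum_eq (h : IsParentMap G root par d) (f : V → ℝ) {v : V} (hv : v ≠ root) :
    pathSum par d f v = pathSum par d f (par v) + f v := by
  simp [pathSum, h.depth_eq v hv, Finset.sum_range_succ']

lemma pathSum_mono (h : IsParentMap G root par d) {f g : V → ℝ}
    (hfg : ∀ v, v ≠ root → f v ≤ g v) (v : V) : pathSum par d f v ≤ pathSum par d g v := by
  induction v using h.induction_par with
  | hroot => simp [h.pathSum_root]
  | hstep v hv ih =>
    rw [h.pathSum_eq f hv, h.pathSum_eq g hv]
    exact add_le_add ih (hfg v hv)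

lemma pathSum_nonneg (h : IsParentMap G root par d) {f : V → ℝ}
    (hf : ∀ v, v ≠ root → 0 ≤ f v) (v : V) : 0 ≤ pathSum par d f v := by
  simpa [pathSum] using h.pathSum_mono (f := fun _ => 0) hf v

lemma sum_neighborFinset_mul_pathSum [G.LocallyFinite] [DecidableEq V]
    (h : IsParentMap G root par d)
    {c : V → V → ℝ} (hc : ∀ u v, G.Adj u v → 0 < c u v) (hsymm : ∀ u v, c u v = c v u)
    (j : V → ℝ) {x y : V} (hxy : G.Adj x y) :
    ∑ w ∈ G.neighborFinset x, c x w / (∑ w ∈ G.neighborFinset x, c x w) *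
        pathSum par d (fun v => j v / c (par v) v) w =
      pathSum par d (fun v => j v / c (par v) v) x +
        (∑ w ∈ h.children x, j w - if x = root then 0 else j x) /
          ∑ w ∈ G.neighborFinset x, c x w := by
  set F := pathSum par d fun v => j v / c (par v) v with hF
  set π := ∑ w ∈ G.neighborFinset x, c x w with hπ
  have hπpos : 0 < π := Finset.sum_pos (fun w hw => hc _ _ (by simpa using hw)) ⟨y, by simpa⟩
  have hchild : ∀ w ∈ h.children x, c x w * (F w - F x) = j w := by
    intro w hw
    have := (hc _ _ (h.mem_children.1 hw).1).ne'
    rw [hF, h.pathSum_eq _ (h.ne_root_of_mem_children hw), h.par_of_mem_children hw]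
    field_simp
    ring
  have hdiff : ∑ w ∈ G.neighborFinset x, c x w * (F w - F x) =
      ∑ w ∈ h.children x, j w - if x = root then 0 else j x := by
    by_cases hx : x = root
    · rw [if_pos hx, sub_zero]
      subst hx
      rw [h.neighborFinset_root]
      exact Finset.sum_congr rfl hchild
    · rw [h.sum_neighborFinset hx, Finset.sum_congr rfl hchild, if_neg hx]
      have := (hc _ _ (h.adj_par x hx)).ne'
      rw [hsymm, hF, h.pathSum_eq _ hx]
      field_simp
      ring
  rw [← hdiff, Finset.sum_div, ← sub_eq_iff_eq_add']
  have h1 : F x = ∑ w ∈ G.neighborFinset x, c x w / π * F x := by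
    rw [← Finset.sum_mul, ← Finset.sum_div, ← hπ, div_self hπpos.ne', one_mul]
  conv_lhs => rw [h1]
  rw [← Finset.sum_sub_distrib]
  exact Finset.sum_congr rfl fun w _ => by ring

lemma countable [G.LocallyFinite] (h : IsParentMap G root par d) : Countable V := by
  have hfin : ∀ n, {v | d v = n}.Finite := by
    intro n
    induction n with
    | zero =>
      refine (Set.finite_singleton root).subset fun v hv => ?_
      by_contra hne
      have := h.depth_eq v hne
      simp only [Set.mem_ofPred_eq] at hv
      omega
    | succ n ih =>
      refine (ih.biUnion fun u _ => (G.neighborFinset u).finite_toSet).subset fun v hv => ?_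
      have hv' : d v = n + 1 := hv
      have hne : v ≠ root := by
        rintro rfl
        rw [h.depth_root] at hv'
        omega
      have := h.depth_eq v hne
      exact Set.mem_biUnion (show d (par v) = n by omega) (by simpa using h.adj_par v hne)
  rw [← Set.countable_univ_iff]
  refine (Set.countable_iUnion fun n => (hfin n).countable).mono fun v _ => ?_
  exact Set.mem_iUnion.2 ⟨d v, rfl⟩

/-- The descendants of `v`, including `v` itself. -/
def descendants (par : V → V) (d : V → ℕ) (v : V) : Set V :=
  {x | d v ≤ d x ∧ par^[d x - d v] x = v}

lemma indicator_add_sum_children_le [G.LocallyFinite] (h : IsParentMap G root par d)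
    {e : V → ℝ} (he : ∀ x, 0 ≤ e x) (v x : V) :
    ({v} : Set V).indicator e x + ∑ c ∈ h.children v, (descendants par d c).indicator e x
      ≤ (descendants par d v).indicator e x := by
  by_cases hxv : x = v
  · subst hxv
    rw [Finset.sum_eq_zero]
    · simp [descendants]
    · intro c hc
      refine Set.indicator_of_notMem (fun hx => ?_) _
      have h1 := hx.1
      have h2 := (h.mem_children.1 hc).2
      omega
  · rw [Set.indicator_of_notMem (by simpa using hxv), zero_add]
    by_cases hex : ∃ c ∈ h.children v, x ∈ descendants par d c
    · obtain ⟨c, hc, hx⟩ := hex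
      have hdc := (h.mem_children.1 hc).2
      rw [Finset.sum_eq_single_of_mem c hc, Set.indicator_of_mem hx, Set.indicator_of_mem]
      · refine ⟨by have := hx.1; omega, ?_⟩
        have h1 : d x - d v = (d x - d c) + 1 := by have := hx.1; omega
        rw [h1, Function.iterate_succ_apply', hx.2, h.par_of_mem_children hc]
      · intro c' hc' hne
        refine Set.indicator_of_notMem (fun hx' => hne ?_) _
        have hdc' := (h.mem_children.1 hc').2
        rw [← hx.2, ← hx'.2, hdc, hdc']
    · push Not at hex
      rw [Finset.sum_eq_zero fun c hc => Set.indicator_of_notMem (hex c hc) _]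
      exact Set.indicator_nonneg (fun x _ => he x) x

/-- The sum of `e` over the descendants of `v`. -/
noncomputable def subtreeSum (par : V → V) (d : V → ℕ) (e : V → ℝ) (v : V) : ℝ :=
  ∑' x, (descendants par d v).indicator e x

lemma subtreeSum_nonneg {e : V → ℝ} (he : ∀ x, 0 ≤ e x) (v : V) :
    0 ≤ subtreeSum par d e v :=
  tsum_nonneg fun x => Set.indicator_nonneg (fun x _ => he x) x

lemma add_sum_subtreeSum_le [G.LocallyFinite] (h : IsParentMap G root par d)
    {e : V → ℝ} (he : ∀ x, 0 ≤ e x) (hs : Summable e) (v : V) :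
    e v + ∑ c ∈ h.children v, subtreeSum par d e c ≤ subtreeSum par d e v := by
  have hsi : ∀ s : Set V, Summable (s.indicator e) := hs.indicator
  have h1 : e v = ∑' x, ({v} : Set V).indicator e x := by
    rw [tsum_eq_single v fun x hx => Set.indicator_of_notMem (by simpa using hx) _]
    simp
  unfold subtreeSum
  rw [h1, ← Summable.tsum_finsetSum fun c _ => hsi _,
    ← (hsi _).tsum_add (summable_sum fun c _ => hsi _)]
  exact ((hsi _).add (summable_sum fun c _ => hsi _)).tsum_le_tsum
    (h.indicator_add_sum_children_le he v) (hsi _)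

/-- On a network carrying a unit flow of finite energy, there is a nonnegative outward
flow `j` whose divergence is nonnegative everywhere and positive at the root, and whose potential
drops add up to at most `1` along every path from the root. -/
lemma exists_bounded_potential [G.LocallyFinite] [DecidableEq V]
    (h : IsParentMap G root par d) {c : V → V → ℝ} (hc : ∀ u v, G.Adj u v → 0 < c u v)
    {θ : V → V → ℝ} (hθ : IsUnitFlow G root θ)
    (hs : Summable fun p : V × V => θ p.1 p.2 ^ 2 / c p.1 p.2) :
    ∃ j : V → ℝ, (∀ v, 0 ≤ j v) ∧ 0 < ∑ w ∈ h.children root, j w ∧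
      (∀ v, v ≠ root → j v ≤ ∑ w ∈ h.children v, j w) ∧
      ∀ v, pathSum par d (fun x => j x / c (par x) x) v ≤ 1 := by
  obtain ⟨hanti, hsupp, hdiv, hdivroot⟩ := hθ
  set e : V → ℝ := fun x => θ (par x) x ^ 2 / c (par x) x with he_def
  have he : ∀ x, 0 ≤ e x := by
    intro x
    by_cases hx : x = root
    · simp [he_def, hx, h.par_root, hsupp root root (G.loopless.irrefl root)]
    · exact div_nonneg (sq_nonneg _) (hc _ _ (h.adj_par x hx)).le
  have hes : Summable e :=
    hs.comp_injective (i := fun x => (par x, x)) fun x y hxy => (Prod.ext_iff.1 hxy).2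
  set S := subtreeSum par d e with hS_def
  have hS : ∀ v, 0 ≤ S v := subtreeSum_nonneg he
  have hSrec : ∀ v, e v + ∑ w ∈ h.children v, S w ≤ S v := h.add_sum_subtreeSum_le he hes
  have heS : ∀ v, e v ≤ S v := fun v =>
    le_of_add_le_of_nonneg_left (hSrec v) (Finset.sum_nonneg fun w _ => hS w)
  have hθS : ∀ v, v ≠ root → S v = 0 → θ (par v) v = 0 := by
    intro v hv hSv
    have h1 : e v = 0 := le_antisymm (hSv ▸ heS v) (he v)
    simpa [he_def, (hc _ _ (h.adj_par v hv)).ne'] using h1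
  set g : V → ℝ := fun v => θ (par v) v ^ 2 / S v with hg_def
  have hg : ∀ v, 0 ≤ g v := fun v => div_nonneg (sq_nonneg _) (hS v)
  set a : V → ℝ := fun v => 1 - e v / S v with ha_def
  have ha : ∀ v, 0 ≤ a v := fun v => sub_nonneg.2 (div_le_one_of_le₀ (heS v) (hS v))
  have hga : ∀ v, v ≠ root → g v ≤ a v * ∑ w ∈ h.children v, g w := by
    intro v hv
    by_cases hSv : S v = 0
    · simp only [hg_def, ha_def, hSv, div_zero, sub_zero, one_mul]
      exact Finset.sum_nonneg fun w _ => hg w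
    · have hSpos : 0 < S v := lt_of_le_of_ne (hS v) (Ne.symm hSv)
      have hflow : θ (par v) v = ∑ w ∈ h.children v, θ v w := by
        have := hdiv v hv
        rw [h.sum_neighborFinset hv, hanti] at this
        linarith
      have hcs : (∑ w ∈ h.children v, θ v w) ^ 2 ≤
          (∑ w ∈ h.children v, S w) * ∑ w ∈ h.children v, g w := by
        refine Finset.sum_sq_le_sum_mul_sum_of_sq_le_mul _ (fun w _ => hS w) (fun w _ => hg w) ?_
        intro w hw
        have hpw := h.par_of_mem_children hw
        by_cases hSw : S w = 0
        · have := hθS w (h.ne_root_of_mem_children hw) hSw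
          rw [hpw] at this
          simp [this, hSw]
        · simp only [hg_def, hpw]
          exact (mul_div_cancel₀ _ hSw).ge
      have h2 : θ (par v) v ^ 2 ≤ (S v - e v) * ∑ w ∈ h.children v, g w := by
        rw [hflow]
        refine hcs.trans (mul_le_mul_of_nonneg_right ?_ (Finset.sum_nonneg fun w _ => hg w))
        linarith [hSrec v]
      have h3 : a v = (S v - e v) / S v := by
        simp only [ha_def]
        field_simp
      rw [h3, div_mul_eq_mul_div]
      exact div_le_div_of_nonneg_right h2 hSpos.le
  set u : V → ℝ := fun v => ∏ i ∈ Finset.range (d v), a (par^[i] v) with hu_def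
  have hu : ∀ v, 0 ≤ u v := fun v => Finset.prod_nonneg fun i _ => ha _
  have hu_root : u root = 1 := by simp [hu_def, h.depth_root]
  have hu_rec : ∀ v, v ≠ root → u v = u (par v) * a v := fun v hv => by
    simp [hu_def, h.depth_eq v hv, Finset.prod_range_succ']
  have hsum : ∀ v, ∑ w ∈ h.children v, u (par w) * g w = u v * ∑ w ∈ h.children v, g w := by
    intro v
    rw [Finset.mul_sum]
    exact Finset.sum_congr rfl fun w hw => by rw [h.par_of_mem_children hw]
  refine ⟨fun v => u (par v) * g v, fun v => mul_nonneg (hu _) (hg v), ?_, ?_, ?_⟩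
  · rw [hsum, hu_root, one_mul]
    refine lt_of_le_of_ne (Finset.sum_nonneg fun w _ => hg w) fun h0 => ?_
    rw [h.neighborFinset_root, Finset.sum_eq_zero] at hdivroot
    · exact zero_ne_one hdivroot
    · intro w hw
      have h1 := (Finset.sum_eq_zero_iff_of_nonneg fun w _ => hg w).1 h0.symm w hw
      have hwr := h.ne_root_of_mem_children hw
      rw [← h.par_of_mem_children hw]
      rcases div_eq_zero_iff.1 h1 with h2 | h2
      · exact pow_eq_zero_iff (two_ne_zero) |>.1 h2
      · exact h.par_of_mem_children hw ▸ hθS w hwr h2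
  · intro v hv
    rw [hsum, hu_rec v hv, mul_assoc]
    exact mul_le_mul_of_nonneg_left (hga v hv) (hu _)
  · intro v
    have key : pathSum par d (fun x => u (par x) * g x / c (par x) x) v = 1 - u v := by
      induction v using h.induction_par with
      | hroot => simp [h.pathSum_root, hu_root]
      | hstep v hv ih =>
        rw [h.pathSum_eq _ hv, ih, hu_rec v hv]
        simp only [ha_def, hg_def, he_def]
        ring
    rw [key]
    linarith [hu v]

end IsParentMap

lemma IsUnitFlow.reroot {V : Type*} {G : SimpleGraph V} [G.LocallyFinite] [DecidableEq V]
    {u v : V} {θ : V → V → ℝ} (hθ : IsUnitFlow G u θ) (huv : G.Adj u v) :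
    IsUnitFlow G v fun a b =>
      θ a b + (if a = v ∧ b = u then 1 else 0) - (if a = u ∧ b = v then 1 else 0) := by
  obtain ⟨hanti, hsupp, hdiv, hdivroot⟩ := hθ
  have hne := huv.ne
  have hsum : ∀ a x y, G.Adj x y → ∑ b ∈ G.neighborFinset a, (if a = x ∧ b = y then (1 : ℝ) else 0)
      = if a = x then 1 else 0 := by
    intro a x y hxy
    by_cases ha : a = x
    · subst ha
      simp [hxy]
    · simp [ha]
  refine ⟨?_, ?_, ?_, ?_⟩
  · intro a b
    simp only [hanti a b, and_comm (a := b = v), and_comm (a := b = u)]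
    ring
  · intro a b hab
    have h1 : ¬ (a = v ∧ b = u) := fun h => hab (h.1 ▸ h.2 ▸ huv.symm)
    have h2 : ¬ (a = u ∧ b = v) := fun h => hab (h.1 ▸ h.2 ▸ huv)
    simp [h1, h2, hsupp a b hab]
  · intro a ha
    rw [Finset.sum_sub_distrib, Finset.sum_add_distrib, hsum _ _ _ huv.symm, hsum _ _ _ huv]
    by_cases hau : a = u
    · subst hau
      simp [ha, hdivroot]
    · simp [ha, hau, hdiv a hau]
  · rw [Finset.sum_sub_distrib, Finset.sum_add_distrib, hsum _ _ _ huv.symm, hsum _ _ _ huv]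
    simp [hne.symm, hdiv v hne.symm]

lemma SimpleGraph.Connected.exists_isUnitFlow {V : Type*} {G : SimpleGraph V} [G.LocallyFinite]
    [DecidableEq V] (hG : G.Connected) {root : V} {c : V → V → ℝ}
    (h : ∃ θ, IsUnitFlow G root θ ∧ Summable fun p : V × V => θ p.1 p.2 ^ 2 / c p.1 p.2) (v : V) :
    ∃ θ, IsUnitFlow G v θ ∧ Summable fun p : V × V => θ p.1 p.2 ^ 2 / c p.1 p.2 := by
  obtain ⟨p⟩ := hG root v
  induction p with
  | nil => exact h
  | @cons a b _ hab p ih =>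
    refine ih ?_
    obtain ⟨θ, hθ, hs⟩ := h
    refine ⟨_, hθ.reroot hab, (summable_congr_cofinite ?_).2 hs⟩
    have hfin : ({(a, b), (b, a)} : Set (V × V)).Finite := by simp
    filter_upwards [hfin.compl_mem_cofinite] with p hp
    have h1 : ¬ (p.1 = b ∧ p.2 = a) := fun h => hp (by simp [Prod.ext_iff, h])
    have h2 : ¬ (p.1 = a ∧ p.2 = b) := fun h => hp (by simp [Prod.ext_iff, h])
    simp [h1, h2]

section CondExp

variable {Ω V : Type*} {m m0 : MeasurableSpace Ω} {μ : Measure Ω}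

lemma setLIntegral_eq_lintegral_condExp_mul [IsFiniteMeasure μ] (hm : m ≤ m0) {A : Set Ω}
    (hA : NullMeasurableSet A μ) {f : Ω → ENNReal} (hf : Measurable[m] f) :
    ∫⁻ ω in A, f ω ∂μ =
      ∫⁻ ω, ENNReal.ofReal ((μ[A.indicator (fun _ => (1 : ℝ)) | m]) ω) * f ω ∂μ := by
  have hint : Integrable (A.indicator fun _ => (1 : ℝ)) μ :=
    (integrable_const 1).indicator₀ hA
  have hnn : 0 ≤ᵐ[μ] μ[A.indicator (fun _ => (1 : ℝ)) | m] :=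
    condExp_nonneg (.of_forall fun ω => Set.indicator_nonneg (fun _ _ => zero_le_one) ω)
  set q : Ω → ENNReal := fun ω => ENNReal.ofReal ((μ[A.indicator (fun _ => (1 : ℝ)) | m]) ω)
  have hq : Measurable q :=
    (stronglyMeasurable_condExp.measurable.mono hm le_rfl).ennreal_ofReal
  have htrim : (μ.restrict A).trim hm = (μ.withDensity q).trim hm := by
    refine @Measure.ext _ m _ _ fun s hs => ?_
    rw [trim_measurableSet_eq hm hs, trim_measurableSet_eq hm hs, Measure.restrict_apply (hm s hs),
      withDensity_apply _ (hm s hs),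
      ← ofReal_integral_eq_lintegral_ofReal integrable_condExp.integrableOn
        (ae_restrict_of_ae hnn), setIntegral_condExp hm hint hs,
      integral_indicator₀ (hA.mono_ac Measure.restrict_le_self.absolutelyContinuous),
      Measure.restrict_restrict₀ (hA.mono_ac Measure.restrict_le_self.absolutelyContinuous)]
    simp [Set.inter_comm, Measure.real]
  rw [← lintegral_trim hm hf, htrim, lintegral_trim hm hf,
    lintegral_withDensity_eq_lintegral_mul _ hq (hf.mono hm le_rfl)]
  rfl

lemma nullMeasurableSet_of_tsum_condExp [Countable V] [IsProbabilityMeasure μ] (hm : m ≤ m0)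
    {Y : Ω → V}
    (h : ∀ᵐ ω ∂μ, ∑' v, ENNReal.ofReal
      ((μ[(Y ⁻¹' {v}).indicator (fun _ => (1 : ℝ)) | m]) ω) = 1) (v : V) :
    NullMeasurableSet (Y ⁻¹' {v}) μ := by
  classical
  by_contra hv
  set S : V → Set Ω := fun w => if NullMeasurableSet (Y ⁻¹' {w}) μ then Y ⁻¹' {w} else ∅ with hS
  have hSsub : ∀ w, S w ⊆ Y ⁻¹' {w} := by
    intro w
    simp only [hS]
    split_ifs <;> simp
  have hSm : ∀ w, NullMeasurableSet (S w) μ := by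
    intro w
    simp only [hS]
    split_ifs with hw
    exacts [hw, .empty]
  have hSd : Pairwise (Function.onFun (AEDisjoint μ) S) := fun a b hab =>
    (Disjoint.mono (hSsub a) (hSsub b)
      (Disjoint.preimage Y (Set.disjoint_singleton.2 hab))).aedisjoint
  have hSμ : ∀ w, μ (S w) = ∫⁻ ω, ENNReal.ofReal
      ((μ[(Y ⁻¹' {w}).indicator (fun _ => (1 : ℝ)) | m]) ω) ∂μ := by
    intro w
    by_cases hw : NullMeasurableSet (Y ⁻¹' {w}) μ
    · simpa [hS, hw] using
        setLIntegral_eq_lintegral_condExp_mul (f := fun _ => 1) hm hw measurable_const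
    · rw [condExp_of_not_integrable]
      · simp [hS, hw]
      · exact fun hi => hw ((aemeasurable_indicator_const_iff (1 : ℝ)).1 hi.aemeasurable)
  have hU : μ (⋃ w, S w) = 1 := by
    rw [measure_iUnion₀ hSd hSm, tsum_congr hSμ, ← lintegral_tsum, lintegral_congr_ae h]
    · simp
    · exact fun w =>
        (stronglyMeasurable_condExp.measurable.mono hm le_rfl).ennreal_ofReal.aemeasurable
  suffices hsub : Y ⁻¹' {v} ⊆ (⋃ w, S w)ᶜ by
    exact hv (NullMeasurableSet.of_null (measure_mono_null hsub
      ((prob_compl_eq_zero_iff₀ (NullMeasurableSet.iUnion hSm)).2 hU)))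
  intro ω hω hω'
  obtain ⟨w, hw⟩ := Set.mem_iUnion.1 hω'
  have hwv : w = v := by rw [← (hSsub w hw : Y ω = w), (hω : Y ω = v)]
  subst hwv
  simp [hS, hv] at hw

lemma lintegral_comp_eq_lintegral_tsum_condExp [Countable V] [IsFiniteMeasure μ] (hm : m ≤ m0)
    {Y : Ω → V} (hY : ∀ v, NullMeasurableSet (Y ⁻¹' {v}) μ) {f : V → Ω → ENNReal}
    (hf : ∀ v, Measurable[m] (f v)) :
    ∫⁻ ω, f (Y ω) ω ∂μ = ∫⁻ ω, ∑' v, ENNReal.ofReal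
      ((μ[(Y ⁻¹' {v}).indicator (fun _ => (1 : ℝ)) | m]) ω) * f v ω ∂μ := by
  have hU : ⋃ v, Y ⁻¹' {v} = Set.univ := by
    rw [← Set.preimage_iUnion, Set.iUnion_of_singleton, Set.preimage_univ]
  have hmeas : ∀ v, AEMeasurable (fun ω => ENNReal.ofReal
      ((μ[(Y ⁻¹' {v}).indicator (fun _ => (1 : ℝ)) | m]) ω) * f v ω) μ := fun v =>
    ((stronglyMeasurable_condExp.measurable.mono hm le_rfl).ennreal_ofReal.mul
      ((hf v).mono hm le_rfl)).aemeasurable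
  rw [lintegral_tsum hmeas, ← setLIntegral_univ, ← hU,
    lintegral_iUnion₀ hY fun a b hab =>
      (Disjoint.preimage Y (Set.disjoint_singleton.2 hab)).aedisjoint]
  refine tsum_congr fun v => ?_
  rw [← setLIntegral_eq_lintegral_condExp_mul hm (hY v) (hf v)]
  refine lintegral_congr_ae ?_
  filter_upwards [ae_restrict_mem₀ (hY v)] with ω hω
  rw [(hω : Y ω = v)]

end CondExp

lemma tsum_ofReal_adj_mul {V : Type*} {T : SimpleGraph V} [T.LocallyFinite] [DecidableRel T.Adj]
    (x : V) (p : V → ℝ) (f : V → ENNReal) :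
    ∑' v, ENNReal.ofReal (if T.Adj x v then p v else 0) * f v =
      ∑ v ∈ T.neighborFinset x, ENNReal.ofReal (p v) * f v := by
  rw [tsum_eq_sum (s := T.neighborFinset x)]
  · exact Finset.sum_congr rfl fun v hv => by rw [if_pos (by simpa using hv)]
  · intro v hv
    rw [if_neg (by simpa using hv)]
    simp

/-- An adapted walk on a tree with decreasing conductances, bounded below by a network carrying a
unit flow of finite energy from `root`, visits `root` finitely often. -/
lemma ae_finite_visits_root {V : Type*} {T : SimpleGraph V} [T.LocallyFinite] [DecidableEq V]
    [DecidableRel T.Adj] (hT : T.IsTree) (root : V)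
    {Ω : Type*} {m0 : MeasurableSpace Ω} {μ : Measure Ω} [IsProbabilityMeasure μ]
    (𝓕 : Filtration ℕ m0) (X : ℕ → Ω → V) (C : ℕ → V → V → Ω → ℝ)
    (hCadp : ∀ t u v, Measurable[𝓕 t] (C t u v))
    (hsymm : ∀ t u v ω, C t u v ω = C t v u ω)
    (hmono : ∀ᵐ ω ∂μ, ∀ t u v, C (t + 1) u v ω ≤ C t u v ω)
    (Cinf : V → V → ℝ) (hCinfpos : ∀ u v, T.Adj u v → 0 < Cinf u v)
    (hbound : ∀ᵐ ω ∂μ, ∀ t u v, Cinf u v ≤ C t u v ω)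
    (htrans : ∃ θ : V → V → ℝ, IsUnitFlow T root θ ∧
      Summable (fun p : V × V => θ p.1 p.2 ^ 2 / Cinf p.1 p.2))
    (hnn : ∀ᵐ ω ∂μ, ∀ t, T.Adj (X t ω) (X (t + 1) ω))
    (hstep : ∀ t (v : V),
      μ[(fun ω => if X (t + 1) ω = v then (1 : ℝ) else 0) | 𝓕 t]
        =ᵐ[μ] fun ω => if T.Adj (X t ω) v then
          C t (X t ω) v ω / ∑ w ∈ T.neighborFinset (X t ω), C t (X t ω) w ω
          else 0) :
    ∀ᵐ ω ∂μ, {t | X t ω = root}.Finite := by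
  obtain ⟨par, d, h⟩ := hT.exists_isParentMap root
  obtain ⟨θ, hθ, hs⟩ := htrans
  obtain ⟨j, hj, hjroot, hjdiv, hjpot⟩ := h.exists_bounded_potential hCinfpos hθ hs
  have : Countable V := h.countable
  set δ := ∑ w ∈ h.children root, j w with hδ
  set π : ℕ → V → Ω → ℝ := fun t x ω => ∑ w ∈ T.neighborFinset x, C t x w ω with hπ
  set F : ℕ → V → Ω → ℝ := fun t v ω =>
    IsParentMap.pathSum par d (fun x => j x / C t (par x) x ω) v with hF
  have hind : ∀ t v, (X (t + 1) ⁻¹' {v}).indicator (fun _ => (1 : ℝ)) =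
      fun ω => if X (t + 1) ω = v then (1 : ℝ) else 0 := fun t v => by
    ext ω
    by_cases hω : X (t + 1) ω = v
    · rw [Set.indicator_of_mem (show ω ∈ X (t + 1) ⁻¹' {v} from hω), if_pos hω]
    · rw [Set.indicator_of_notMem (show ω ∉ X (t + 1) ⁻¹' {v} from hω), if_neg hω]
  replace hstep : ∀ t (v : V), μ[(X (t + 1) ⁻¹' {v}).indicator (fun _ => (1 : ℝ)) | 𝓕 t]
      =ᵐ[μ] fun ω => if T.Adj (X t ω) v then C t (X t ω) v ω / π t (X t ω) ω else 0 := by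
    intro t v
    rw [hind]
    exact hstep t v
  have htsum : ∀ (t : ℕ) (f : V → Ω → ENNReal), ∀ᵐ ω ∂μ, ∑' v, ENNReal.ofReal
      ((μ[(X (t + 1) ⁻¹' {v}).indicator (fun _ => (1 : ℝ)) | 𝓕 t]) ω) * f v ω =
      ∑ v ∈ T.neighborFinset (X t ω),
        ENNReal.ofReal (C t (X t ω) v ω / π t (X t ω) ω) * f v ω := by
    intro t f
    filter_upwards [ae_all_iff.2 (hstep t)] with ω hω
    exact (tsum_congr fun v => by rw [hω v]).trans (tsum_ofReal_adj_mul (X t ω) _ _)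
  have hpos : ∀ᵐ ω ∂μ, ∀ t u v, T.Adj u v → 0 < C t u v ω := by
    filter_upwards [hbound] with ω hω t u v huv
    exact (hCinfpos u v huv).trans_le (hω t u v)
  have hnull : ∀ t v, NullMeasurableSet (X (t + 1) ⁻¹' {v}) μ := by
    intro t
    refine nullMeasurableSet_of_tsum_condExp (𝓕.le t) ?_
    filter_upwards [htsum t fun _ _ => 1, hpos, hnn] with ω h1 h2 h3
    simp only [mul_one] at h1
    have hπpos : 0 < π t (X t ω) ω :=
      Finset.sum_pos (fun w hw => h2 _ _ _ (by simpa using hw)) ⟨_, by simpa using h3 t⟩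
    rw [h1, ← ENNReal.ofReal_sum_of_nonneg, ← Finset.sum_div, div_self hπpos.ne',
      ENNReal.ofReal_one]
    exact fun w hw => (div_pos (h2 _ _ _ (by simpa using hw)) hπpos).le
  have hFmeas : ∀ t v, Measurable[𝓕 t] (F t v) := fun t v =>
    Finset.measurable_fun_sum _ fun i _ => measurable_const.div (hCadp t _ _)
  have hFnn : ∀ᵐ ω ∂μ, ∀ t v, 0 ≤ F t v ω := by
    filter_upwards [hpos] with ω hω t v
    exact h.pathSum_nonneg (fun x hx => div_nonneg (hj x) (hω _ _ _ (h.adj_par x hx)).le) v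
  have hFle : ∀ᵐ ω ∂μ, ∀ t v, F t v ω ≤ 1 := by
    filter_upwards [hbound] with ω hω t v
    exact (h.pathSum_mono (fun x hx => div_le_div_of_nonneg_left (hj x)
      (hCinfpos _ _ (h.adj_par x hx)) (hω _ _ _)) v).trans (hjpot v)
  have hFmono : ∀ᵐ ω ∂μ, ∀ t v, F t v ω ≤ F (t + 1) v ω := by
    filter_upwards [hpos, hmono] with ω h1 h2 t v
    exact h.pathSum_mono (fun x hx => div_le_div_of_nonneg_left (hj x)
      (h1 _ _ _ (h.adj_par x hx)) (h2 _ _ _)) v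
  set b : ℕ → Ω → ENNReal := fun t =>
    (X t ⁻¹' {root}).indicator fun ω => ENNReal.ofReal (δ / π 0 root ω) with hb
  set a : ℕ → ENNReal := fun t => ∫⁻ ω, ENNReal.ofReal (F t (X t ω) ω) ∂μ with ha
  have hdrift : ∀ᵐ ω ∂μ, ∀ t, ENNReal.ofReal (F t (X t ω) ω) + b t ω ≤
      ∑ v ∈ T.neighborFinset (X t ω),
        ENNReal.ofReal (C t (X t ω) v ω / π t (X t ω) ω) * ENNReal.ofReal (F t v ω) := by
    filter_upwards [hpos, hmono, hnn, hFnn] with ω h1 h2 h3 h4 t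
    have hanti : Antitone fun t => π t root ω :=
      antitone_nat_of_succ_le fun t => Finset.sum_le_sum fun w _ => h2 t root w
    have hπpos : 0 < π t (X t ω) ω :=
      Finset.sum_pos (fun w hw => h1 _ _ _ (by simpa using hw)) ⟨_, by simpa using h3 t⟩
    have hp : ∀ v ∈ T.neighborFinset (X t ω), 0 ≤ C t (X t ω) v ω / π t (X t ω) ω :=
      fun w hw => (div_pos (h1 _ _ _ (by simpa using hw)) hπpos).le
    have hsum := h.sum_neighborFinset_mul_pathSum (c := fun u v => C t u v ω) (h1 t)
      (fun u v => hsymm t u v ω) j (h3 t)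
    rw [Finset.sum_congr rfl fun v hv => (ENNReal.ofReal_mul (hp v hv)).symm,
      ← ENNReal.ofReal_sum_of_nonneg fun v hv => mul_nonneg (hp v hv) (h4 t v)]
    simp only [hF, hπ] at hsum ⊢
    rw [hsum]
    by_cases hx : X t ω = root
    · have hle : δ / π 0 root ω ≤ δ / π t root ω :=
        div_le_div_of_nonneg_left hjroot.le (hx ▸ hπpos) (hanti (Nat.zero_le t))
      have hnn0 : 0 ≤ δ / π 0 root ω :=
        div_nonneg hjroot.le ((hx ▸ hπpos).le.trans (hanti (Nat.zero_le t)))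
      simp only [hb, Set.indicator_of_mem (show ω ∈ X t ⁻¹' {root} from hx)]
      rw [← ENNReal.ofReal_add (h4 t _) hnn0]
      refine ENNReal.ofReal_le_ofReal (add_le_add le_rfl ?_)
      rw [if_pos hx, sub_zero, hx]
      exact hle
    · simp only [hb, Set.indicator_of_notMem (show ω ∉ X t ⁻¹' {root} from hx), add_zero]
      refine ENNReal.ofReal_le_ofReal (le_add_of_nonneg_right (div_nonneg ?_ hπpos.le))
      rw [if_neg hx]
      exact sub_nonneg.2 (hjdiv _ hx)
  have hab : ∀ t, a t + ∫⁻ ω, b t ω ∂μ ≤ a (t + 1) := by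
    intro t
    calc a t + ∫⁻ ω, b t ω ∂μ
        ≤ ∫⁻ ω, ENNReal.ofReal (F t (X t ω) ω) + b t ω ∂μ := le_lintegral_add _ _
      _ ≤ ∫⁻ ω, ∑' v, ENNReal.ofReal
            ((μ[(X (t + 1) ⁻¹' {v}).indicator (fun _ => (1 : ℝ)) | 𝓕 t]) ω) *
              ENNReal.ofReal (F t v ω) ∂μ := by
          refine lintegral_mono_ae ?_
          filter_upwards [hdrift, htsum t fun v ω => ENNReal.ofReal (F t v ω)] with ω h1 h2
          exact h2 ▸ h1 t
      _ = ∫⁻ ω, ENNReal.ofReal (F t (X (t + 1) ω) ω) ∂μ :=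
          (lintegral_comp_eq_lintegral_tsum_condExp (𝓕.le t) (hnull t)
            (f := fun v ω => ENNReal.ofReal (F t v ω))
            fun v => (hFmeas t v).ennreal_ofReal).symm
      _ ≤ a (t + 1) := by
          refine lintegral_mono_ae ?_
          filter_upwards [hFmono] with ω hω
          exact ENNReal.ofReal_le_ofReal (hω t _)
  have ha1 : ∀ t, a t ≤ 1 := by
    intro t
    calc a t ≤ ∫⁻ _, 1 ∂μ := by
          refine lintegral_mono_ae ?_
          filter_upwards [hFle] with ω hω
          exact ENNReal.ofReal_le_one.2 (hω t _)
      _ = 1 := by simp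
  have hsumb : ∀ n, ∑ t ∈ Finset.range n, ∫⁻ ω, b (t + 1) ω ∂μ ≤ a (n + 1) := by
    intro n
    induction n with
    | zero => simp
    | succ n ih =>
      rw [Finset.sum_range_succ]
      exact (add_le_add_left ih _).trans (hab (n + 1))
  have hbmeas : ∀ t, AEMeasurable (b (t + 1)) μ := fun t =>
    (Measurable.ennreal_ofReal (measurable_const.div (Finset.measurable_fun_sum _ fun w _ =>
      (hCadp 0 root w).mono (𝓕.le 0) le_rfl))).aemeasurable.indicator₀ (hnull t root)
  have hfin : ∫⁻ ω, ∑' t, b (t + 1) ω ∂μ ≠ ⊤ := by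
    rw [lintegral_tsum hbmeas]
    refine ne_top_of_le_ne_top ENNReal.one_ne_top ?_
    exact ENNReal.tsum_le_of_sum_range_le fun n => (hsumb n).trans (ha1 _)
  filter_upwards [ae_lt_top' (.tsum hbmeas) hfin, hpos] with ω h1 h2
  have hπ0 : 0 < π 0 root ω := by
    refine Finset.sum_pos (fun w hw => h2 _ _ _ (by simpa using hw)) ?_
    rw [h.neighborFinset_root]
    exact Finset.nonempty_of_sum_ne_zero hjroot.ne'
  have hset := ENNReal.finite_const_le_of_tsum_ne_top h1.ne
    (ENNReal.ofReal_pos.2 (div_pos hjroot hπ0)).ne'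
  refine ((hset.image Nat.succ).insert 0).subset fun t ht => ?_
  cases t with
  | zero => exact Set.mem_insert _ _
  | succ t =>
    refine Set.mem_insert_of_mem _ ⟨t, ?_, rfl⟩
    simp [hb, Set.indicator_of_mem (show ω ∈ X (t + 1) ⁻¹' {root} from ht)]

/-- **Theorem 5.2:** a monotone decreasing adaptive RWCE on a locally finite tree `T`
with root `root`, bounded below by conductances `Cinf` whose network is transient
(by T. Lyons' criterion: some unit flow from the root to infinity has finite energy),
visits every vertex only finitely many times almost surely. -/
theorem rwce_tree_decreasing_transient
    {V : Type*} (T : SimpleGraph V) [T.LocallyFinite] [DecidableEq V]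
    [DecidableRel T.Adj] (hconn : T.Connected) (hacyclic : T.IsAcyclic) (root : V)
    {Ω : Type*} {m0 : MeasurableSpace Ω} {μ : Measure Ω} [IsProbabilityMeasure μ]
    (𝓕 : Filtration ℕ m0) [MeasurableSpace V]
    (X : ℕ → Ω → V) (C : ℕ → V → V → Ω → ℝ)
    (hXadp : ∀ t, Measurable[𝓕 t] (X t))
    (hCadp : ∀ t u v, Measurable[𝓕 t] (C t u v))
    (hsymm : ∀ t u v ω, C t u v ω = C t v u ω)
    (hmono : ∀ᵐ ω ∂μ, ∀ t u v, C (t + 1) u v ω ≤ C t u v ω)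
    (Cinf : V → V → ℝ) (hCinfpos : ∀ u v, T.Adj u v → 0 < Cinf u v)
    (hbound : ∀ᵐ ω ∂μ, ∀ t u v, Cinf u v ≤ C t u v ω)
    (htrans : ∃ θ : V → V → ℝ, IsUnitFlow T root θ ∧
      Summable (fun p : V × V => θ p.1 p.2 ^ 2 / Cinf p.1 p.2))
    (hnn : ∀ᵐ ω ∂μ, ∀ t, T.Adj (X t ω) (X (t + 1) ω))
    (hstep : ∀ t (v : V),
      μ[(fun ω => if X (t + 1) ω = v then (1 : ℝ) else 0) | 𝓕 t]
        =ᵐ[μ] fun ω => if T.Adj (X t ω) v then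
          C t (X t ω) v ω / ∑ w ∈ T.neighborFinset (X t ω), C t (X t ω) w ω
          else 0) :
    ∀ᵐ ω ∂μ, ∀ v : V, {t | X t ω = v}.Finite := by
  have hT : T.IsTree := ⟨hconn, hacyclic⟩
  obtain ⟨par, d, h⟩ := hT.exists_isParentMap root
  have : Countable V := h.countable
  refine ae_all_iff.2 fun v => ?_
  exact ae_finite_visits_root hT v 𝓕 X C hCadp hsymm hmono Cinf hCinfpos hbound
    (hconn.exists_isUnitFlow htrans v) hnn hstep
end
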